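/- Let n ≥ 2 and let π ∈ S_n be an involution, i.e., π∘π = id (fixed points allowed). Then the IO-polynomial F_π(z) is log-concave. -/

import Mathlib

open Finset Polynomial

/-- Number of cycles of a permutation, counting fixed points as cycles of length 1
(equivalently, the number of orbits). -/
noncomputable def cycleCount {α : Type*} [Fintype α] [DecidableEq α] (σ : Equiv.Perm α) : ℕ :=
  σ.cycleType.card + (Finset.univ.filter fun x => σ x = x).card

/-- The IO-polynomial `F_π(z) = Σ_{ζ ∈ Q_n} z^⌊(c(ζπ)-1)/2⌋`, where `Q_n` is the set of
`n`-cycles of `S_n` (i.e. permutations with a single cycle), and `ζπ` applies `ζ` first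
and then `π`. -/
noncomputable def IOPoly {n : ℕ} (π : Equiv.Perm (Fin n)) : Polynomial ℝ :=
  ∑ ζ ∈ Finset.univ.filter (fun ζ : Equiv.Perm (Fin n) => cycleCount ζ = 1),
    Polynomial.X ^ ((cycleCount (π * ζ) - 1) / 2)

section CycleCount

open Equiv Equiv.Perm

theorem Equiv.Perm.SameCycle.of_forall_rel {α : Type*} [Finite α] {τ : Perm α}
    {r : α → α → Prop} (hr : Equivalence r)
    (h : ∀ x, r x (τ x)) {x y : α} (hxy : SameCycle τ x y) : r x y := by
  obtain ⟨k, rfl⟩ := hxy.exists_nat_pow_eq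
  induction k with
  | zero => exact hr.refl _
  | succ k ih =>
    rw [pow_succ', mul_apply]
    exact hr.trans (ih ⟨k, by simp⟩) (h _)

variable {α : Type*} [Fintype α] [DecidableEq α]

theorem cycleCount_eq_card_quotient (σ : Perm α) :
    cycleCount σ = Nat.card (Quotient (SameCycle.setoid σ)) := by
  let F : α → Perm α ⊕ α := fun x => if σ x = x then .inr x else .inl (σ.cycleOf x)
  have hF : ∀ x y, F x = F y ↔ SameCycle σ x y := by
    intro x y
    by_cases hx : σ x = x <;> by_cases hy : σ y = y
    · simp only [F, hx, hy, if_true, Sum.inr.injEq]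
      exact ⟨fun h => h ▸ SameCycle.refl _ _, fun h => h.eq_of_left hx⟩
    · simp only [F, hx, hy, if_true, if_false, reduceCtorEq, false_iff]
      exact fun h => hy (by rw [← h.eq_of_left hx, hx])
    · simp only [F, hx, hy, if_true, if_false, reduceCtorEq, false_iff]
      exact fun h => hx (by rw [h.eq_of_right hy, hy])
    · simp only [F, hx, hy, if_false, Sum.inl.injEq]
      exact (sameCycle_iff_cycleOf_eq_of_mem_support (mem_support.2 hx) (mem_support.2 hy)).symm
  let e : Quotient (SameCycle.setoid σ) → Perm α ⊕ α :=
    Quotient.lift F fun a b h => (hF a b).2 h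
  have he : Function.Injective e := by
    rintro ⟨a⟩ ⟨b⟩ h
    exact Quotient.sound ((hF a b).1 h)
  have hrange : Set.range e =
      ((σ.cycleFactorsFinset.disjSum (univ.filter fun x => σ x = x) : Finset _) : Set _) := by
    ext z
    constructor
    · rintro ⟨⟨a⟩, rfl⟩
      change F a ∈ _
      by_cases ha : σ a = a
      · simp [F, ha]
      · simp [F, ha, cycleOf_mem_cycleFactorsFinset_iff]
    · intro hz
      rcases z with c | x
      · have hc : c ∈ σ.cycleFactorsFinset := by simpa using hz
        obtain ⟨x, hx⟩ := (mem_cycleFactorsFinset_iff.1 hc).1.nonempty_support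
        have hxs : σ x ≠ x := mem_support.1 (mem_cycleFactorsFinset_support_le hc hx)
        refine ⟨Quotient.mk _ x, ?_⟩
        change F x = _
        simp [F, hxs, (cycle_is_cycleOf hx hc).symm]
      · have hx : σ x = x := by simpa using hz
        refine ⟨Quotient.mk _ x, ?_⟩
        change F x = _
        simp [F, hx]
  rw [← Nat.card_range_of_injective he, hrange]
  simp [cycleCount, cycleType_def]

theorem cycleCount_add_card_support (σ : Perm α) :
    cycleCount σ + #σ.support = σ.cycleType.card + Fintype.card α := by
  have h : (univ.filter fun x => σ x = x) = σ.supportᶜ := by ext; simp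
  have := card_le_univ σ.support
  rw [cycleCount, h, card_compl]
  lia

theorem cycleCount_eq_of_cycleType_eq {β : Type*} [Fintype β] [DecidableEq β]
    {σ : Perm α} {τ : Perm β} (hc : Fintype.card α = Fintype.card β)
    (h : σ.cycleType = τ.cycleType) : cycleCount σ = cycleCount τ := by
  have h1 := cycleCount_add_card_support σ
  have h2 := cycleCount_add_card_support τ
  rw [← sum_cycleType] at h1 h2
  rw [h] at h1
  lia

theorem cycleCount_mul_comm (σ τ : Perm α) : cycleCount (σ * τ) = cycleCount (τ * σ) :=
  cycleCount_eq_of_cycleType_eq rfl <| by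
    rw [← cycleType_conj (σ := σ * τ) (τ := τ)]
    simp [mul_assoc]

theorem cycleCount_permCongr {β : Type*} [Fintype β] [DecidableEq β] (e : α ≃ β) (σ : Perm α) :
    cycleCount (e.permCongr σ) = cycleCount σ := by
  simp_rw [cycleCount_eq_card_quotient]
  refine (Nat.card_congr (Quotient.congr e fun a b => ?_)).symm
  change SameCycle _ _ _ ↔ SameCycle _ _ _
  refine exists_congr fun i => ?_
  have : (e.permCongr σ) ^ i = e.permCongr (σ ^ i) := (map_zpow e.permCongrHom σ i).symm
  simp [this]

theorem neg_one_pow_cycleCount (σ : Perm α) :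
    (-1 : ℤˣ) ^ cycleCount σ = (-1) ^ Fintype.card α * sign σ := by
  have h := cycleCount_add_card_support σ
  rw [sign_of_cycleType, sum_cycleType, pow_add, mul_left_comm, ← pow_add,
    add_comm (Fintype.card α), ← h, pow_add, mul_left_comm, ← pow_add, ← two_mul]
  simp

theorem cycleCount_pos [Nonempty α] (σ : Perm α) : 0 < cycleCount σ := by
  have : Nonempty (Quotient (SameCycle.setoid σ)) := ⟨Quotient.mk _ (Classical.arbitrary α)⟩
  rw [cycleCount_eq_card_quotient]
  exact Nat.card_pos

theorem cycleCount_optionCongr (σ : Perm α) : cycleCount (optionCongr σ) = cycleCount σ + 1 := by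
  let e : Quotient (SameCycle.setoid (optionCongr σ)) ≃ Option (Quotient (SameCycle.setoid σ)) :=
  { toFun := Quotient.lift (Option.map (Quotient.mk _)) fun a b h => by
      refine SameCycle.of_forall_rel
        (r := fun a b => Option.map (Quotient.mk _) a = Option.map (Quotient.mk _) b)
        ⟨fun _ => rfl, Eq.symm, Eq.trans⟩ ?_ h
      rintro (_ | x)
      · rfl
      · simp only [optionCongr_apply, Option.map_some, Option.some.injEq]
        exact Quotient.sound ⟨1, by simp⟩
    invFun := fun z => z.elim (Quotient.mk _ none) (Quotient.lift
      (fun x => Quotient.mk _ (some x)) fun a b h => by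
      refine SameCycle.of_forall_rel
        (r := fun a b =>
          Quotient.mk (SameCycle.setoid (optionCongr σ)) (some a) = Quotient.mk _ (some b))
        ⟨fun _ => rfl, Eq.symm, Eq.trans⟩ ?_ h
      exact fun x => Quotient.sound ⟨1, by simp⟩)
    left_inv := by rintro ⟨_ | x⟩ <;> rfl
    right_inv := by rintro (_ | ⟨⟨x⟩⟩) <;> rfl }
  rw [cycleCount_eq_card_quotient, Nat.card_congr e, Finite.card_option,
    cycleCount_eq_card_quotient]

theorem cycleCount_swap_none_mul_optionCongr (i : α) (σ : Perm α) :
    cycleCount (swap none (some i) * optionCongr σ) = cycleCount σ := by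
  set τ := swap none (some i) * optionCongr σ with hτ
  have hnone : τ none = some i := by simp [hτ]
  have hsome : ∀ x, τ (some x) = if σ x = i then none else some (σ x) := by
    intro x
    split_ifs with h
    · simp [hτ, h]
    · simp [hτ, swap_apply_of_ne_of_ne, h]
  let e : Quotient (SameCycle.setoid τ) ≃ Quotient (SameCycle.setoid σ) :=
  { toFun := Quotient.lift (fun z => Quotient.mk _ (z.getD i)) fun a b h => by
      refine SameCycle.of_forall_rel
        (r := fun a b => Quotient.mk (SameCycle.setoid σ) (a.getD i) = Quotient.mk _ (b.getD i))
        ⟨fun _ => rfl, Eq.symm, Eq.trans⟩ ?_ h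
      rintro (_ | x)
      · rw [hnone]; rfl
      · rw [hsome]
        refine Quotient.sound ⟨1, ?_⟩
        split_ifs with hx <;> simp [hx]
    invFun := Quotient.lift (fun x => Quotient.mk _ (some x)) fun a b h => by
      refine SameCycle.of_forall_rel
        (r := fun a b => (Quotient.mk (SameCycle.setoid τ) (some a)) = Quotient.mk _ (some b))
        ⟨fun _ => rfl, Eq.symm, Eq.trans⟩ ?_ h
      intro x
      by_cases hx : σ x = i
      · exact Quotient.sound ⟨2, by simp [zpow_ofNat, pow_two, hsome, hx, hnone]⟩
      · exact Quotient.sound ⟨1, by simp [hsome, hx]⟩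
    left_inv := by
      rintro ⟨_ | x⟩
      · exact Quotient.sound (SameCycle.symm ⟨1, by simp [hnone]⟩)
      · rfl
    right_inv := by rintro ⟨x⟩; rfl }
  rw [cycleCount_eq_card_quotient, Nat.card_congr e, cycleCount_eq_card_quotient]

end CycleCount

section CharpolyRev

open Equiv Matrix

variable {n R : Type*} [Fintype n] [DecidableEq n] [CommRing R]

theorem Matrix.derivative_det (M : Matrix n n R[X]) :
    derivative M.det = ∑ i, (M.updateCol i fun k => derivative (M k i)).det := by
  simp_rw [det_apply, derivative_sum]
  rw [Finset.sum_comm]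
  refine Finset.sum_congr rfl fun σ _ => ?_
  have hs (p : R[X]) : derivative (Perm.sign σ • p) = Perm.sign σ • derivative p := by
    rcases Int.units_eq_one_or (Perm.sign σ) with h | h <;> simp [h]
  rw [← Finset.smul_sum, hs, derivative_prod_finset]
  congr 1
  refine Finset.sum_congr rfl fun i _ => ?_
  rw [← Finset.mul_prod_erase univ _ (Finset.mem_univ i), mul_comm]
  congr 1
  · simp
  · exact Finset.prod_congr rfl fun j hj => by simp [Finset.ne_of_mem_erase hj]

theorem Matrix.X_mul_derivative_charpolyRev (A : Matrix n n R) :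
    X * derivative A.charpolyRev = (Fintype.card n : R[X]) * A.charpolyRev
      - trace (adjugate (1 - (X : R[X]) • A.map C)) := by
  set B : Matrix n n R[X] := 1 - (X : R[X]) • A.map C with hB
  have hdet : A.charpolyRev = B.det := rfl
  rw [hdet, derivative_det, Finset.mul_sum, trace]
  have : ∀ i, X * (B.updateCol i fun k => derivative (B k i)).det = B.det - adjugate B i i := by
    intro i
    have h1 : (X : R[X]) • (fun k => derivative (B k i)) = (fun k => B k i) + -Pi.single i 1 := by
      ext1 k
      by_cases hk : k = i
      · subst hk; simp [hB]; ring
      · simp [hB, hk]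
    rw [← det_updateCol_smul, h1, det_updateCol_add, updateCol_eq_self, ← neg_one_smul R[X],
      det_updateCol_smul, ← cramer_apply, cramer_eq_adjugate_mulVec]
    simp [sub_eq_add_neg]
  simp [this, Finset.sum_sub_distrib]

theorem Matrix.det_updateRow_eq_vecMul_adjugate (B : Matrix n n R) (i : n) (v : n → R) :
    (B.updateRow i v).det = (v ᵥ* adjugate B) i := by
  rw [← cramer_transpose_apply, cramer_eq_adjugate_mulVec, ← adjugate_transpose, mulVec_transpose]

theorem Matrix.det_sub_vecMulVec_single_sub_single (B : Matrix n n R) {i j : n} (hij : i ≠ j)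
    (v : n → R) :
    (B - vecMulVec (Pi.single i 1 - Pi.single j 1) v).det =
      B.det - (v ᵥ* adjugate B) i + (v ᵥ* adjugate B) j := by
  have h : B - vecMulVec (Pi.single i 1 - Pi.single j 1) v =
      (B.updateRow i (B i + -v)).updateRow j (B j + v) := by
    ext k l
    by_cases hkj : k = j
    · subst hkj; simp [vecMulVec_apply, hij.symm]
    · by_cases hki : k = i
      · subst hki; simp [vecMulVec_apply, hkj, sub_eq_add_neg]
      · simp [vecMulVec_apply, hki, hkj]
  have h0 : ((B.updateRow j v).updateRow i v).det = 0 :=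
    det_zero_of_row_eq hij (by simp [updateRow_ne hij.symm])
  have h1 : (B.updateRow i (B i + -v)).updateRow j (B j) = B.updateRow i (B i + -v) := by
    conv_rhs => rw [← updateRow_eq_self (B.updateRow i (B i + -v)) j, updateRow_ne hij.symm]
  have h2 : (B.updateRow j v).updateRow i (B i) = B.updateRow j v := by
    conv_rhs => rw [← updateRow_eq_self (B.updateRow j v) i, updateRow_ne hij]
  rw [h, det_updateRow_add, h1, updateRow_comm _ hij, det_updateRow_add, det_updateRow_add,
    h2, updateRow_eq_self, ← neg_one_smul R v, det_updateRow_smul, det_updateRow_smul, h0,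
    det_updateRow_eq_vecMul_adjugate, det_updateRow_eq_vecMul_adjugate]
  ring

variable (R) in
/-- The reverse characteristic polynomial `det (1 - X P)` of the permutation matrix `P` of `σ`. -/
noncomputable def permCharpolyRev (σ : Perm n) : R[X] := (σ.permMatrix R).charpolyRev

variable (R) in
/-- The matrix `1 - X P` with `P` the permutation matrix of `σ`. -/
noncomputable def permCharmatrixRev (σ : Perm n) : Matrix n n R[X] :=
  1 - (X : R[X]) • (σ.permMatrix R).map C

omit [Fintype n] in
theorem permCharmatrixRev_apply (σ : Perm n) (i j : n) : permCharmatrixRev R σ i j =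
    (if i = j then 1 else 0) - if σ i = j then X else 0 := by
  by_cases h : σ i = j <;> simp [permCharmatrixRev, Matrix.one_apply, PEquiv.toMatrix_apply, h]

theorem det_permCharmatrixRev (σ : Perm n) :
    (permCharmatrixRev R σ).det = permCharpolyRev R σ := rfl

theorem sum_adjugate_permCharmatrixRev_row (σ : Perm n) (a : n) :
    (1 - X) * ∑ j, adjugate (permCharmatrixRev R σ) a j = permCharpolyRev R σ := by
  have h1 : permCharmatrixRev R σ *ᵥ 1 = (1 - X : R[X]) • 1 := by
    ext1 i; simp [mulVec, dotProduct, permCharmatrixRev_apply]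
  have h2 := congrFun (congrArg (adjugate (permCharmatrixRev R σ) *ᵥ ·) h1) a
  simp only [mulVec_mulVec, adjugate_mul, mulVec_smul] at h2
  simpa [Matrix.one_apply, mulVec, dotProduct, smul_mulVec, det_permCharmatrixRev] using h2.symm

theorem sum_adjugate_permCharmatrixRev_col (σ : Perm n) (a : n) :
    (1 - X) * ∑ j, adjugate (permCharmatrixRev R σ) j a = permCharpolyRev R σ := by
  have h1 : 1 ᵥ* permCharmatrixRev R σ = (1 - X : R[X]) • 1 := by
    ext1 i
    simp [vecMul, dotProduct, permCharmatrixRev_apply, ← Equiv.eq_symm_apply]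
  have h2 := congrFun (congrArg (· ᵥ* adjugate (permCharmatrixRev R σ)) h1) a
  simp only [vecMul_vecMul, mul_adjugate, smul_vecMul] at h2
  simpa [Matrix.one_apply, vecMul, dotProduct, vecMul_smul, det_permCharmatrixRev] using h2.symm

theorem permCharpolyRev_swap_mul (σ : Perm n) {a j : n} (h : a ≠ j) :
    permCharpolyRev R (Equiv.swap a j * σ) = -permCharpolyRev R σ
      + adjugate (permCharmatrixRev R σ) a a + adjugate (permCharmatrixRev R σ) j j
      - adjugate (permCharmatrixRev R σ) a j - adjugate (permCharmatrixRev R σ) j a := by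
  set w : n → R[X] := Pi.single a 1 - Pi.single j 1 with hw
  have hS : (Equiv.swap a j).permMatrix R[X] = 1 - vecMulVec w w := by
    ext k l
    simp only [PEquiv.toMatrix_apply, toPEquiv_apply, Option.mem_def, Option.some.injEq,
      Matrix.sub_apply, Matrix.one_apply, vecMulVec_apply, hw, Pi.sub_apply, Pi.single_apply]
    by_cases hka : k = a
    · subst hka
      by_cases hlk : l = k
      · subst hlk; simp [h, h.symm]
      · by_cases hlj : l = j
        · subst hlj; simp [h, h.symm]
        · simp [h, hlk, hlj, Ne.symm hlk, Ne.symm hlj]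
    · by_cases hkj : k = j
      · subst hkj
        by_cases hlk : l = k
        · subst hlk; simp [h, h.symm]
        · by_cases hla : l = a
          · subst hla; simp [h, h.symm]
          · simp [h.symm, hlk, hla, Ne.symm hlk, Ne.symm hla]
      · simp [swap_apply_of_ne_of_ne, hka, hkj]
  have hm : permCharmatrixRev R (Equiv.swap a j * σ) =
      (permCharmatrixRev R σ - vecMulVec w w) * (Equiv.swap a j).permMatrix R[X] := by
    have e1 : permCharmatrixRev R σ - vecMulVec w w =
        (Equiv.swap a j).permMatrix R[X] - (X : R[X]) • σ.permMatrix R[X] := by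
      rw [hS]
      ext k l : 1
      simp only [permCharmatrixRev_apply, Matrix.sub_apply, Matrix.one_apply, Matrix.smul_apply,
        PEquiv.toMatrix_apply, toPEquiv_apply, Option.mem_def, Option.some.injEq]
      by_cases hk : σ k = l <;> simp [hk] ; ring
    rw [e1, sub_mul, smul_mul, ← permMatrix_mul, ← permMatrix_mul, Equiv.swap_mul_self,
      permMatrix_one]
    ext k l : 1
    simp only [permCharmatrixRev_apply, Matrix.sub_apply, Matrix.one_apply, Matrix.smul_apply,
        PEquiv.toMatrix_apply, toPEquiv_apply, Option.mem_def, Option.some.injEq]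
    by_cases hl : Equiv.swap a j (σ k) = l <;> simp [hl]
  rw [← det_permCharmatrixRev, hm, det_mul, det_permutation, hw,
    det_sub_vecMulVec_single_sub_single _ h, det_permCharmatrixRev, Perm.sign_swap h, sub_vecMul]
  simp
  ring

theorem permCharpolyRev_swap_none_mul_optionCongr (σ : Perm n) (a : n) :
    permCharpolyRev R (Equiv.swap none (some a) * optionCongr σ) =
      X * permCharpolyRev R σ + (1 - X) * adjugate (permCharmatrixRev R σ) a a := by
  set B := permCharmatrixRev R σ with hB
  set b := σ⁻¹ a with hb
  have hbk : ∀ k, σ k = a ↔ k = b := fun k => by rw [hb, Perm.eq_inv_iff_eq]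
  set U : Matrix n Unit R[X] := of fun k _ => if k = b then -X else 0 with hU
  set V : Matrix Unit n R[X] := of fun _ l => if l = a then -X else 0 with hV
  have h1 : (permCharmatrixRev R (Equiv.swap none (some a) * optionCongr σ)).submatrix
      (optionEquivSumPUnit.{0} n).symm (optionEquivSumPUnit.{0} n).symm =
      fromBlocks (B.updateRow b (B b + (X : R[X]) • Pi.single a 1)) U V 1 := by
    ext i j : 1
    rcases i with i | i <;> rcases j with j | j
    · by_cases hi : i = b
      · have := (hbk i).2 hi
        subst hi
        by_cases hj : j = a
        · subst hj
          simp [permCharmatrixRev_apply, hB, this]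
        · simp [permCharmatrixRev_apply, hB, this, hj, Ne.symm hj]
      · have := mt (hbk i).1 hi
        simp [permCharmatrixRev_apply, hB, hi, swap_apply_of_ne_of_ne, this]
    · by_cases hi : i = b
      · have := (hbk i).2 hi
        subst hi
        simp [permCharmatrixRev_apply, this, hU]
      · have := mt (hbk i).1 hi
        simp [permCharmatrixRev_apply, hi, hU, swap_apply_of_ne_of_ne, this]
    · by_cases hj : j = a
      · simp [permCharmatrixRev_apply, hj, hV]
      · simp [permCharmatrixRev_apply, hj, Ne.symm hj, hV]
    · simp [permCharmatrixRev_apply]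
  have h2 : B.updateRow b (B b + (X : R[X]) • Pi.single a 1) - U * V =
      B.updateRow b (B b + (X - X ^ 2 : R[X]) • Pi.single a 1) := by
    ext i j : 1
    by_cases hi : i = b
    · subst hi
      by_cases hj : j = a
      · simp [hj, Matrix.mul_apply, hU, hV]; ring
      · simp [hj, Matrix.mul_apply, hU, hV]
    · simp [hi, Matrix.mul_apply, hU, hV]
  have h3 : adjugate B a a - X * adjugate B a b = permCharpolyRev R σ := by
    have := congrFun₂ (adjugate_mul B) a a
    simpa [Matrix.mul_apply, hB, permCharmatrixRev_apply, mul_sub, Finset.sum_sub_distrib, hbk,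
      det_permCharmatrixRev, mul_comm] using this
  rw [← det_permCharmatrixRev, ← det_submatrix_equiv_self (optionEquivSumPUnit n).symm, h1,
    det_fromBlocks_one₂₂, h2, det_updateRow_add, updateRow_eq_self, det_updateRow_smul,
    ← adjugate_apply, hB, det_permCharmatrixRev]
  linear_combination (X - 1) * h3

theorem permCharpolyRev_optionCongr (σ : Perm n) :
    permCharpolyRev R (optionCongr σ) = (1 - X) * permCharpolyRev R σ := by
  have h1 : (permCharmatrixRev R (optionCongr σ)).submatrix
      (optionEquivSumPUnit.{0} n).symm (optionEquivSumPUnit.{0} n).symm =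
      fromBlocks (permCharmatrixRev R σ) 0 0 (of fun _ _ => 1 - X) := by
    ext i j : 1
    rcases i with i | i <;> rcases j with j | j <;> simp [permCharmatrixRev_apply]
  rw [← det_permCharmatrixRev, ← det_submatrix_equiv_self (optionEquivSumPUnit.{0} n).symm, h1,
    det_fromBlocks_zero₂₁, det_permCharmatrixRev]
  simp [mul_comm]

theorem one_sub_X_mul_sum_permCharpolyRev_swap_mul (σ : Perm n) (a : n) :
    (1 - X) * ∑ j, permCharpolyRev R (Equiv.swap a j * σ) =
      (Fintype.card n : R[X]) * permCharpolyRev R (Equiv.swap none (some a) * optionCongr σ)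
        - ((Fintype.card n : R[X]) + 2) * X * permCharpolyRev R σ
        - X * (1 - X) * derivative (permCharpolyRev R σ) := by
  have hrow := sum_adjugate_permCharmatrixRev_row (R := R) σ a
  have hcol := sum_adjugate_permCharmatrixRev_col (R := R) σ a
  have htr := X_mul_derivative_charpolyRev (σ.permMatrix R)
  have hsum : ∑ j, permCharpolyRev R (Equiv.swap a j * σ) = 2 * permCharpolyRev R σ +
      ∑ j, (-permCharpolyRev R σ
        + adjugate (permCharmatrixRev R σ) a a + adjugate (permCharmatrixRev R σ) j j
        - adjugate (permCharmatrixRev R σ) a j - adjugate (permCharmatrixRev R σ) j a) := by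
    rw [← Finset.add_sum_erase _ _ (Finset.mem_univ a),
      ← Finset.add_sum_erase (a := a) _ (fun j => -permCharpolyRev R σ + _ + _ - _ - _)
        (Finset.mem_univ a), ← add_assoc]
    congr 1
    · simp [← Equiv.Perm.one_def]; ring
    · exact Finset.sum_congr rfl fun j hj =>
        permCharpolyRev_swap_mul σ (Finset.ne_of_mem_erase hj).symm
  rw [hsum, permCharpolyRev_swap_none_mul_optionCongr]
  simp only [Finset.sum_sub_distrib, Finset.sum_add_distrib, Finset.sum_const, Finset.card_univ,
    nsmul_eq_mul]
  change X * derivative (permCharpolyRev R σ) = (Fintype.card n : R[X]) * permCharpolyRev R σ -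
    ∑ j, adjugate (permCharmatrixRev R σ) j j at htr
  linear_combination (1 - X) * htr - hrow - hcol

theorem permCharpolyRev_permCongr {m : Type*} [Fintype m] [DecidableEq m] (e : n ≃ m)
    (σ : Perm n) : permCharpolyRev R (e.permCongr σ) = permCharpolyRev R σ := by
  rw [← det_permCharmatrixRev, ← det_permCharmatrixRev, ← det_submatrix_equiv_self e]
  congr 1
  ext i j : 1
  simp [permCharmatrixRev_apply]

end CharpolyRev

section ShiftedPochhammer

/-- The linear map sending `X ^ r` to the shifted rising factorial
`(X - r) (X - r + 1) ⋯ (X - r + N)`. -/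
noncomputable def shiftedPochhammer (N : ℕ) : ℂ[X] →ₗ[ℂ] ℂ[X] :=
  LinearMap.applyₗ (ascPochhammer ℂ (N + 1)) ∘ₗ
    (aeval (taylor (-1 : ℂ)) : ℂ[X] →ₐ[ℂ] Module.End ℂ ℂ[X]).toLinearMap

theorem shiftedPochhammer_one (N : ℕ) : shiftedPochhammer N 1 = ascPochhammer ℂ (N + 1) := by
  simp [shiftedPochhammer]

theorem shiftedPochhammer_X_mul (N : ℕ) (p : ℂ[X]) :
    shiftedPochhammer N (X * p) = taylor (-1) (shiftedPochhammer N p) := by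
  simp [shiftedPochhammer]

theorem taylor_neg_one_ascPochhammer_succ (N : ℕ) :
    taylor (-1) (ascPochhammer ℂ (N + 1)) = (X - 1) * ascPochhammer ℂ N := by
  rw [ascPochhammer_succ_left, taylor_mul, taylor_X, taylor_apply, comp_assoc]
  simp [sub_eq_add_neg]

theorem taylor_natCast_add_two (r : ℂ) (N : ℕ) :
    taylor r ((N : ℂ[X]) + 2) = (N : ℂ[X]) + 2 := by
  have h : (N : ℂ[X]) + 2 = C ((N : ℂ) + 2) := by simp [map_ofNat C 2]
  rw [h, taylor_C]

theorem shiftedPochhammer_succ_one_sub_X_mul (N : ℕ) (p : ℂ[X]) :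
    shiftedPochhammer (N + 1) ((1 - X) * p) = ((N : ℂ[X]) + 2) * shiftedPochhammer N p := by
  induction p using Polynomial.induction_on' with
  | add p q hp hq => rw [mul_add, map_add, hp, hq, map_add, mul_add]
  | monomial r c =>
    rw [← C_mul_X_pow_eq_monomial, ← smul_eq_C_mul, mul_smul_comm, map_smul, map_smul,
      mul_smul_comm]
    congr 1
    induction r with
    | zero =>
      have h := shiftedPochhammer_X_mul (N + 1) 1
      rw [mul_one] at h
      rw [pow_zero, mul_one, map_sub, h, shiftedPochhammer_one, shiftedPochhammer_one,
        taylor_neg_one_ascPochhammer_succ, ascPochhammer_succ_right]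
      push_cast
      ring
    | succ r ih =>
      rw [pow_succ', mul_left_comm, shiftedPochhammer_X_mul, ih, shiftedPochhammer_X_mul,
        taylor_mul, taylor_natCast_add_two]

theorem mul_X_sub_one_mul_shiftedPochhammer (N : ℕ) (p : ℂ[X]) :
    ((N : ℂ[X]) + 2) * (X - 1) * shiftedPochhammer N p =
      shiftedPochhammer (N + 1) (((N : ℂ[X]) + 2) * X * p + X * (1 - X) * derivative p) := by
  induction p using Polynomial.induction_on' with
  | add p q hp hq =>
    rw [map_add, mul_add, hp, hq, ← map_add, map_add derivative]
    congr 1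
    ring
  | monomial r c =>
    rw [← C_mul_X_pow_eq_monomial, ← smul_eq_C_mul, map_smul, derivative_smul, mul_smul_comm,
      mul_smul_comm, mul_smul_comm, ← smul_add, map_smul]
    congr 1
    induction r with
    | zero =>
      have h : ((N : ℂ[X]) + 2) * X * X ^ 0 + X * (1 - X) * derivative (X ^ 0) =
          ((N : ℂ) + 2) • (X * 1 : ℂ[X]) := by
        simp [smul_eq_C_mul, map_ofNat C 2]
      rw [h, map_smul, shiftedPochhammer_X_mul, pow_zero, shiftedPochhammer_one,
        shiftedPochhammer_one, taylor_neg_one_ascPochhammer_succ, smul_eq_C_mul]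
      simp [mul_assoc, map_ofNat C 2]
    | succ r ih =>
      have h : ((N : ℂ[X]) + 2) * X * X ^ (r + 1) + X * (1 - X) * derivative (X ^ (r + 1)) =
          X * (((N : ℂ[X]) + 2) * X * X ^ r + X * (1 - X) * derivative (X ^ r)) +
            X * ((1 - X) * X ^ r) := by
        rw [pow_succ', derivative_mul, derivative_X]
        ring
      rw [h, map_add, shiftedPochhammer_X_mul, shiftedPochhammer_X_mul, ← ih,
        shiftedPochhammer_succ_one_sub_X_mul, pow_succ', shiftedPochhammer_X_mul]
      simp only [taylor_mul, map_sub, taylor_X, taylor_one, taylor_natCast_add_two, C_neg, C_1]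
      ring

end ShiftedPochhammer

section LongCycleCount

open Equiv

variable {α : Type*} [Fintype α] [DecidableEq α]

/-- The generating polynomial `∑ X ^ c(π ζ)` over all long cycles `ζ`. -/
noncomputable def longCycleGenFun (π : Perm α) : ℂ[X] :=
  ∑ ζ : Perm α, if cycleCount ζ = 1 then X ^ cycleCount (π * ζ) else 0

theorem longCycleGenFun_permCongr {β : Type*} [Fintype β] [DecidableEq β] (e : α ≃ β)
    (π : Perm α) : longCycleGenFun (e.permCongr π) = longCycleGenFun π := by
  unfold longCycleGenFun
  refine (Fintype.sum_equiv e.permCongr _ _ fun ζ => ?_).symm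
  rw [cycleCount_permCongr, ← permCongr_mul, cycleCount_permCongr]

theorem longCycleGenFun_option [Nonempty α] (π : Perm (Option α)) :
    longCycleGenFun π = ∑ ζ : Perm α, if cycleCount ζ = 1 then
      ∑ i, X ^ cycleCount (π * (swap none (some i) * optionCongr ζ)) else 0 := by
  unfold longCycleGenFun
  rw [← Fintype.sum_equiv Perm.decomposeOption.symm _ _ fun _ => rfl, Fintype.sum_prod_type_right]
  refine Finset.sum_congr rfl fun ζ _ => ?_
  have h0 : cycleCount ζ ≠ 0 := (cycleCount_pos ζ).ne'
  simp only [Fintype.sum_option, Perm.decomposeOption_symm_apply,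
    cycleCount_swap_none_mul_optionCongr]
  have : cycleCount (swap none none * optionCongr ζ) ≠ 1 := by
    rw [swap_self, ← Perm.one_def, one_mul, cycleCount_optionCongr]
    simpa using h0
  rw [if_neg this, zero_add]
  split_ifs <;> simp

omit [Fintype α] in
theorem optionCongr_mul_swap_mul (h ζ : Perm α) (i : α) :
    optionCongr h * (swap none (some i) * optionCongr ζ) =
      swap none (some (h i)) * optionCongr (h * ζ) := by
  have : optionCongr (h * ζ) = optionCongr h * optionCongr ζ := optionCongr_trans _ _
  rw [this, ← mul_assoc, ← mul_assoc, mul_swap_eq_swap_mul]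
  simp

theorem longCycleGenFun_optionCongr [Nonempty α] (h : Perm α) :
    longCycleGenFun (optionCongr h) = (Fintype.card α : ℂ[X]) * longCycleGenFun h := by
  rw [longCycleGenFun_option, longCycleGenFun, Finset.mul_sum]
  refine Finset.sum_congr rfl fun ζ _ => ?_
  simp [optionCongr_mul_swap_mul, cycleCount_swap_none_mul_optionCongr]

theorem longCycleGenFun_swap_none_mul [Nonempty α] (h : Perm α) (a : α) :
    longCycleGenFun (swap none (some a) * optionCongr h) =
      (X - 1) * longCycleGenFun h + ∑ j, longCycleGenFun (swap a j * h) := by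
  simp_rw [longCycleGenFun_option, longCycleGenFun]
  rw [Finset.sum_comm, Finset.mul_sum, ← Finset.sum_add_distrib]
  refine Finset.sum_congr rfl fun ζ _ => ?_
  split_ifs with hζ
  swap
  · simp
  simp_rw [mul_assoc, optionCongr_mul_swap_mul]
  rw [Equiv.sum_comp h fun j => (X : ℂ[X]) ^
    cycleCount (swap none (some a) * (swap none (some j) * optionCongr (h * ζ))),
    ← Finset.add_sum_erase _ _ (Finset.mem_univ a),
    ← Finset.add_sum_erase _ (fun j => (X : ℂ[X]) ^ cycleCount (swap a j * (h * ζ)))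
      (Finset.mem_univ a), ← add_assoc]
  congr 1
  · rw [swap_self, ← mul_assoc, swap_mul_self, one_mul, ← Perm.one_def, one_mul,
      cycleCount_optionCongr]
    ring
  · refine Finset.sum_congr rfl fun j hj => ?_
    have hja : j ≠ a := Finset.ne_of_mem_erase hj
    have hs : swap none (some a) * swap none (some j) =
        optionCongr (swap a j) * swap none (some a) := by
      rw [optionCongr_swap, mul_swap_eq_swap_mul, swap_apply_left,
        swap_apply_of_ne_of_ne (by simp) (by simpa using hja)]
    have hm : optionCongr (h * ζ * swap a j) = optionCongr (h * ζ) * optionCongr (swap a j) :=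
      optionCongr_trans _ _
    rw [← mul_assoc, hs, mul_assoc, cycleCount_mul_comm, mul_assoc, ← hm,
      cycleCount_swap_none_mul_optionCongr, cycleCount_mul_comm]

theorem longCycleGenFun_option_eq [Nonempty α]
    (ih : ∀ π : Perm α, (Fintype.card α : ℂ[X]) * (Fintype.card α + 1) * longCycleGenFun π =
      shiftedPochhammer (Fintype.card α) (permCharpolyRev ℂ π)) (π : Perm (Option α)) :
    (Fintype.card (Option α) : ℂ[X]) * (Fintype.card (Option α) + 1) * longCycleGenFun π =
      shiftedPochhammer (Fintype.card (Option α)) (permCharpolyRev ℂ π) := by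
  obtain ⟨⟨o, h⟩, rfl⟩ := Perm.decomposeOption.symm.surjective π
  rw [Perm.decomposeOption_symm_apply, Fintype.card_option]
  set N := Fintype.card α with hN
  have hN0 : (N : ℂ[X]) ≠ 0 := by simp [hN]
  dsimp only
  cases o with
  | none =>
    rw [swap_self, ← Perm.one_def, one_mul, longCycleGenFun_optionCongr,
      permCharpolyRev_optionCongr, shiftedPochhammer_succ_one_sub_X_mul, ← ih]
    push_cast
    ring
  | some a =>
    have hsmul (p : ℂ[X]) : shiftedPochhammer (N + 1) ((N : ℂ[X]) * p) =
        (N : ℂ[X]) * shiftedPochhammer (N + 1) p := by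
      rw [← nsmul_eq_mul, map_nsmul, nsmul_eq_mul]
    have h1 := mul_X_sub_one_mul_shiftedPochhammer N (permCharpolyRev ℂ h)
    have h2 := one_sub_X_mul_sum_permCharpolyRev_swap_mul (R := ℂ) h a
    have h3 := shiftedPochhammer_succ_one_sub_X_mul N
      (∑ j, permCharpolyRev ℂ (Equiv.swap a j * h))
    rw [h2, map_sum] at h3
    simp_rw [← ih] at h3 h1
    rw [← Finset.mul_sum, sub_sub, map_sub, hsmul] at h3
    apply mul_left_cancel₀ hN0
    rw [longCycleGenFun_swap_none_mul]
    push_cast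
    linear_combination h1 - h3

theorem longCycleGenFun_option_eq_of_isEmpty [IsEmpty α] (π : Perm (Option α)) :
    (Fintype.card (Option α) : ℂ[X]) * (Fintype.card (Option α) + 1) * longCycleGenFun π =
      shiftedPochhammer (Fintype.card (Option α)) (permCharpolyRev ℂ π) := by
  obtain rfl : π = optionCongr 1 := Subsingleton.elim _ _
  have hc : cycleCount (optionCongr (1 : Perm α)) = 1 := by
    rw [cycleCount_optionCongr]
    simp [cycleCount]
  have h1 : longCycleGenFun (optionCongr (1 : Perm α)) = X := by
    rw [longCycleGenFun, Fintype.sum_subsingleton _ (optionCongr 1), if_pos hc,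
      Subsingleton.elim (optionCongr 1 * optionCongr 1) (optionCongr (1 : Perm α)), hc, pow_one]
  have h2 : permCharpolyRev ℂ (1 : Perm α) = 1 := Matrix.det_isEmpty
  have h3 := shiftedPochhammer_succ_one_sub_X_mul 0 1
  rw [h1, permCharpolyRev_optionCongr, h2, Fintype.card_option, Fintype.card_eq_zero, h3,
    shiftedPochhammer_one]
  norm_num

theorem longCycleGenFun_eq [Nonempty α] (π : Perm α) :
    (Fintype.card α : ℂ[X]) * (Fintype.card α + 1) * longCycleGenFun π =
      shiftedPochhammer (Fintype.card α) (permCharpolyRev ℂ π) := by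
  classical
  refine Fintype.induction_empty_option (P := fun β _ => Nonempty β →
    ∀ (_ : DecidableEq β) (π : Perm β), (Fintype.card β : ℂ[X]) * (Fintype.card β + 1) *
      longCycleGenFun π = shiftedPochhammer (Fintype.card β) (permCharpolyRev ℂ π))
      ?_ ?_ ?_ α ‹_› _ π
  · intro β γ _ e H hγ _ π
    let hβ := Classical.decEq β
    let := Fintype.ofEquiv _ e.symm
    have := H e.nonempty hβ (e.symm.permCongr π)
    rwa [longCycleGenFun_permCongr, permCharpolyRev_permCongr, Fintype.card_congr e] at this
  · rintro ⟨⟨⟩⟩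
  · intro β _ H _ hd π
    let hd' := Classical.decEq β
    obtain rfl : hd = Option.instDecidableEq := Subsingleton.elim _ _
    rcases isEmpty_or_nonempty β with hβ | hβ
    · exact longCycleGenFun_option_eq_of_isEmpty π
    · exact longCycleGenFun_option_eq (H hβ _) π

end LongCycleCount

section RootLocation

theorem Complex.norm_sub_one_sub_le_norm_sub_iff {z r : ℂ} :
    ‖z - 1 - r‖ ≤ ‖z - r‖ ↔ r.re + 1 / 2 ≤ z.re := by
  rw [← sq_le_sq₀ (norm_nonneg _) (norm_nonneg _), ← Complex.normSq_eq_norm_sq,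
    ← Complex.normSq_eq_norm_sq, Complex.normSq_apply, Complex.normSq_apply]
  simp
  constructor <;> intro h <;> nlinarith

theorem Complex.norm_sub_le_norm_sub_one_sub_iff {z r : ℂ} :
    ‖z - r‖ ≤ ‖z - 1 - r‖ ↔ z.re ≤ r.re + 1 / 2 := by
  rw [← sq_le_sq₀ (norm_nonneg _) (norm_nonneg _), ← Complex.normSq_eq_norm_sq,
    ← Complex.normSq_eq_norm_sq, Complex.normSq_apply, Complex.normSq_apply]
  simp
  constructor <;> intro h <;> nlinarith

theorem norm_eval_eq_prod_roots (Q : ℂ[X]) (z : ℂ) :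
    ‖Q.eval z‖ = ‖Q.leadingCoeff‖ * (Q.roots.map fun r => ‖z - r‖).prod := by
  conv_lhs => rw [(IsAlgClosed.splits Q).eq_prod_roots]
  rw [eval_mul, eval_C, norm_mul, eval_multiset_prod]
  congr 1
  rw [Multiset.map_map]
  simpa using Multiset.prod_hom (Q.roots.map fun r => z - r) (normHom : ℂ →*₀ ℝ) |>.symm

theorem norm_eval_sub_one_le {Q : ℂ[X]} (hQ : Q ≠ 0) {c : ℝ} (h : ∀ z, Q.eval z = 0 → z.re = c)
    {z : ℂ} (hz : c + 1 / 2 ≤ z.re) : ‖Q.eval (z - 1)‖ ≤ ‖Q.eval z‖ := by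
  rw [norm_eval_eq_prod_roots, norm_eval_eq_prod_roots]
  refine mul_le_mul_of_nonneg_left ?_ (norm_nonneg _)
  refine Multiset.prod_map_le_prod_map₀ _ _ (fun _ _ => norm_nonneg _) fun r hr => ?_
  rw [Complex.norm_sub_one_sub_le_norm_sub_iff, h r ((mem_roots hQ).1 hr)]
  exact hz

theorem le_norm_eval_sub_one {Q : ℂ[X]} (hQ : Q ≠ 0) {c : ℝ} (h : ∀ z, Q.eval z = 0 → z.re = c)
    {z : ℂ} (hz : z.re ≤ c + 1 / 2) : ‖Q.eval z‖ ≤ ‖Q.eval (z - 1)‖ := by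
  rw [norm_eval_eq_prod_roots, norm_eval_eq_prod_roots]
  refine mul_le_mul_of_nonneg_left ?_ (norm_nonneg _)
  refine Multiset.prod_map_le_prod_map₀ _ _ (fun _ _ => norm_nonneg _) fun r hr => ?_
  rw [Complex.norm_sub_le_norm_sub_one_sub_iff, h r ((mem_roots hQ).1 hr)]
  exact hz

theorem re_eq_of_eval_eq_zero {Q : ℂ[X]} {m : ℝ} (hm : 0 ≤ m)
    (h : ∀ z, Q.eval z = 0 → z.re = -(m + 1) / 2) {a : ℂ} (ha : ‖a‖ = 1) {z : ℂ}
    (hz : (z - 1) * Q.eval (z - 1) = a * ((z + m + 1) * Q.eval z)) : z.re = -m / 2 := by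
  have hQ : Q ≠ 0 := by
    rintro rfl
    have := h (1 : ℂ) eval_zero
    rw [Complex.one_re] at this
    linarith
  have hn := congrArg norm hz
  rw [norm_mul, norm_mul, norm_mul, ha, one_mul] at hn
  have e1 : ‖z - 1‖ ^ 2 = (z.re - 1) ^ 2 + z.im ^ 2 := by
    rw [← Complex.normSq_eq_norm_sq, Complex.normSq_apply]; simp; ring
  have e2 : ‖z + m + 1‖ ^ 2 = (z.re + m + 1) ^ 2 + z.im ^ 2 := by
    rw [← Complex.normSq_eq_norm_sq, Complex.normSq_apply]; simp; ring
  rcases lt_trichotomy z.re (-m / 2) with hlt | heq | hgt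
  · exfalso
    have h1 := le_norm_eval_sub_one hQ h (z := z) (by linarith)
    have h2 : 0 < ‖Q.eval (z - 1)‖ := norm_pos_iff.2 fun h0 => by
      have := h _ h0
      rw [Complex.sub_re, Complex.one_re] at this
      linarith
    have h3 : ‖z + m + 1‖ < ‖z - 1‖ := by
      rw [← sq_lt_sq₀ (norm_nonneg _) (norm_nonneg _), e1, e2]
      nlinarith
    have := mul_le_mul_of_nonneg_left h1 (norm_nonneg (z + m + 1))
    have := mul_lt_mul_of_pos_right h3 h2
    linarith
  · exact heq
  · exfalso
    have h1 := norm_eval_sub_one_le hQ h (z := z) (by linarith)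
    have h2 : 0 < ‖Q.eval z‖ := norm_pos_iff.2 fun h0 => by
      have := h _ h0
      linarith
    have h3 : ‖z - 1‖ < ‖z + m + 1‖ := by
      rw [← sq_lt_sq₀ (norm_nonneg _) (norm_nonneg _), e1, e2]
      nlinarith
    have := mul_le_mul_of_nonneg_left h1 (norm_nonneg (z - 1))
    have := mul_lt_mul_of_pos_right h3 h2
    linarith

theorem exists_shiftedPochhammer_prod_eq (s : Multiset ℂ) (hs : ∀ a ∈ s, ‖a‖ = 1) (m : ℕ) :
    ∃ Q : ℂ[X], shiftedPochhammer (m + s.card) (s.map fun a => X - C a).prod =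
      ascPochhammer ℂ (m + 1) * Q ∧ ∀ z, Q.eval z = 0 → z.re = -(m : ℝ) / 2 := by
  induction s using Multiset.induction_on generalizing m with
  | empty => exact ⟨1, by simp [shiftedPochhammer_one], by simp⟩
  | cons a s ih =>
    obtain ⟨Q, hQ, hr⟩ := ih (fun b hb => hs b (Multiset.mem_cons_of_mem hb)) (m + 1)
    refine ⟨(X - 1) * taylor (-1) Q - C a * ((X + (m : ℂ[X]) + 1) * Q), ?_, fun z hz => ?_⟩
    · have hcard : m + (a ::ₘ s).card = m + 1 + s.card := by
        rw [Multiset.card_cons]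
        lia
      rw [hcard, Multiset.map_cons, Multiset.prod_cons, sub_mul, map_sub, shiftedPochhammer_X_mul,
        ← smul_eq_C_mul, map_smul, hQ, taylor_mul, taylor_neg_one_ascPochhammer_succ,
        ascPochhammer_succ_right ℂ (m + 1), smul_eq_C_mul]
      push_cast
      ring
    · refine re_eq_of_eval_eq_zero (Q := Q) (Nat.cast_nonneg m) (fun z hz => ?_)
        (hs a (Multiset.mem_cons_self _ _)) ?_
      · simpa using hr z hz
      · simp only [eval_sub, eval_mul, eval_add, eval_X, eval_one, eval_C, eval_natCast,
          taylor_eval] at hz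
        rw [← sub_eq_add_neg] at hz
        simpa using sub_eq_zero.1 hz

end RootLocation

section CharpolyRevRoots

open Equiv Matrix

variable {α : Type*} [Fintype α] [DecidableEq α]

theorem norm_eq_one_of_eval_permCharpolyRev_eq_zero {σ : Perm α} {t : ℂ}
    (h : (permCharpolyRev ℂ σ).eval t = 0) : ‖t‖ = 1 := by
  rw [← det_permCharmatrixRev, ← coe_evalRingHom, RingHom.map_det] at h
  obtain ⟨v, hv, hv0⟩ := exists_mulVec_eq_zero_iff.2 h
  have hrec (i) : v i = t * v (σ i) := by
    have := congrFun hv0 i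
    simpa [mulVec, dotProduct, permCharmatrixRev_apply, apply_ite (eval t), sub_mul,
      Finset.sum_sub_distrib, sub_eq_zero] using this
  have hsum : ∑ i, ‖v i‖ = ‖t‖ * ∑ i, ‖v i‖ := by
    rw [← Equiv.sum_comp σ fun i => ‖v i‖, Finset.mul_sum, Equiv.sum_comp σ fun i => ‖v i‖]
    exact Finset.sum_congr rfl fun i _ => by rw [hrec i, norm_mul]
  have hpos : ∑ i, ‖v i‖ ≠ 0 := by
    intro h0
    rw [Finset.sum_eq_zero_iff_of_nonneg fun _ _ => norm_nonneg _] at h0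
    exact hv (funext fun i => norm_eq_zero.1 (h0 i (Finset.mem_univ i)))
  exact mul_right_cancel₀ hpos (by rw [← hsum, one_mul])

theorem natDegree_permCharpolyRev (σ : Perm α) :
    (permCharpolyRev ℂ σ).natDegree = Fintype.card α := by
  have h : (σ.permMatrix ℂ).charpoly.natTrailingDegree = 0 := by
    refine natTrailingDegree_eq_zero.2 (.inr fun h0 => ?_)
    have := det_eq_sign_charpoly_coeff (σ.permMatrix ℂ)
    rw [h0, mul_zero, det_permutation] at this
    simp at this
  rw [permCharpolyRev, ← reverse_charpoly, reverse_natDegree, h, charpoly_natDegree_eq_dim]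
  rfl

theorem re_eq_zero_of_eval_longCycleGenFun_eq_zero [Nonempty α] {π : Perm α} {z : ℂ}
    (h : (longCycleGenFun π).eval z = 0) : z.re = 0 := by
  set G := permCharpolyRev ℂ π with hG
  have hG0 : G ≠ 0 := by
    intro h0
    have : G.natDegree = Fintype.card α := natDegree_permCharpolyRev π
    rw [h0, natDegree_zero] at this
    exact Fintype.card_ne_zero this.symm
  have hcard : G.roots.card = Fintype.card α := by
    rw [← (IsAlgClosed.splits G).natDegree_eq_card_roots, natDegree_permCharpolyRev]
  obtain ⟨Q, hQ, hr⟩ := exists_shiftedPochhammer_prod_eq G.roots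
    (fun a ha => norm_eq_one_of_eval_permCharpolyRev_eq_zero ((mem_roots hG0).1 ha)) 0
  have hmain := longCycleGenFun_eq π
  rw [← hG, (IsAlgClosed.splits G).eq_prod_roots, ← smul_eq_C_mul, map_smul, ← hcard,
    ← zero_add G.roots.card, hQ] at hmain
  have he := congrArg (eval z) hmain
  simp only [eval_mul, h, mul_zero, eval_smul, smul_eq_mul, zero_add, ascPochhammer_one, eval_X]
    at he
  rcases mul_eq_zero.1 he.symm with h1 | h1
  · exact absurd (leadingCoeff_eq_zero.1 h1) hG0
  · rcases mul_eq_zero.1 h1 with h1 | h1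
    · simp [h1]
    · simpa using hr z h1

end CharpolyRevRoots

section LogConcave

theorem coeff_X_add_C_mul_mul_le {q : ℝ[X]} {b : ℝ} (hb : 0 ≤ b) (h0 : ∀ i, 0 ≤ q.coeff i)
    (h : ∀ i j, i ≤ j → q.coeff i * q.coeff (j + 1) ≤ q.coeff (i + 1) * q.coeff j)
    {i j : ℕ} (hij : i ≤ j) :
    ((X + C b) * q).coeff i * ((X + C b) * q).coeff (j + 1) ≤
      ((X + C b) * q).coeff (i + 1) * ((X + C b) * q).coeff j := by
  rcases hij.eq_or_lt with rfl | hlt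
  · rw [mul_comm]
  obtain ⟨j, rfl⟩ : ∃ k, j = k + 1 := ⟨j - 1, by lia⟩
  have hb2 := mul_le_mul_of_nonneg_left (h i (j + 1) (by lia)) (mul_nonneg hb hb)
  have hi := h i j (by lia)
  cases i with
  | zero =>
    have h1 := mul_nonneg hb (mul_nonneg (h0 1) (h0 j))
    have h2 := mul_nonneg (h0 0) (h0 (j + 1))
    have h3 := mul_nonneg (h0 0) (h0 j)
    simp only [add_mul, coeff_add, coeff_X_mul, coeff_C_mul, coeff_X_mul_zero]
    simp only [zero_add] at *
    nlinarith
  | succ i =>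
    have h1 := h i j (by lia)
    have h2 := h i (j + 1) (by lia)
    have h3 := mul_le_mul_of_nonneg_left (h2.trans hi) hb
    simp only [add_mul, coeff_add, coeff_X_mul, coeff_C_mul]
    nlinarith

theorem coeff_mul_coeff_le_of_roots_nonpos (p : ℝ[X])
    (hp : ∀ w : ℂ, aeval w p = 0 → w.im = 0 ∧ w.re ≤ 0) (hl : 0 ≤ p.leadingCoeff) :
    (∀ i, 0 ≤ p.coeff i) ∧
      ∀ i j, i ≤ j → p.coeff i * p.coeff (j + 1) ≤ p.coeff (i + 1) * p.coeff j := by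
  induction hd : p.natDegree generalizing p with
  | zero =>
    obtain ⟨c, rfl⟩ := natDegree_eq_zero.1 hd
    rw [leadingCoeff_C] at hl
    refine ⟨fun i => ?_, fun i j _ => ?_⟩
    · rw [coeff_C]
      split_ifs <;> simp [hl]
    · simp [coeff_C]
  | succ d ih =>
    obtain ⟨w, hw⟩ := IsAlgClosed.exists_aeval_eq_zero ℂ p (by
      intro h
      rw [natDegree_eq_zero_iff_degree_le_zero.2 h.le] at hd
      lia)
    obtain ⟨him, hre⟩ := hp w hw
    have hwr : w = ((w.re : ℝ) : ℂ) := by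
      apply Complex.ext <;> simp [him]
    rw [hwr] at hw
    have hroot : p.IsRoot w.re := by
      have : ((p.eval w.re : ℝ) : ℂ) = 0 := by
        rw [← hw]
        exact (aeval_algebraMap_apply_eq_algebraMap_eval (A := ℂ) w.re p).symm
      exact_mod_cast this
    obtain ⟨q, hq⟩ := dvd_iff_isRoot.2 hroot
    set b := -w.re with hb
    have hX : (X - C w.re : ℝ[X]) = X + C b := by simp [hb, sub_eq_add_neg]
    rw [hX] at hq
    have hmonic : (X + C b).Monic := monic_X_add_C b
    have hdeg : q.natDegree = d := by
      have hq0 : q ≠ 0 := by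
        rintro rfl
        rw [hq, mul_zero, natDegree_zero] at hd
        lia
      rw [hq, hmonic.natDegree_mul' hq0, natDegree_X_add_C] at hd
      lia
    have hlead : 0 ≤ q.leadingCoeff := by
      rwa [hq, leadingCoeff_monic_mul hmonic] at hl
    obtain ⟨h0, h1⟩ := ih q (fun w hw => hp w (by rw [hq, map_mul, hw, mul_zero])) hlead hdeg
    have hb0 : 0 ≤ b := by linarith
    rw [hq]
    refine ⟨fun i => ?_, fun i j hij => coeff_X_add_C_mul_mul_le hb0 h0 h1 hij⟩
    have := mul_nonneg hb0 (h0 i)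
    cases i with
    | zero => simpa [add_mul] using this
    | succ i =>
      rw [add_mul, coeff_add, coeff_X_mul, coeff_C_mul]
      exact add_nonneg (h0 i) this

end LogConcave

section IOPolynomial

open Equiv

theorem coeff_IOPoly_nonneg {n : ℕ} (π : Perm (Fin n)) (i : ℕ) : 0 ≤ (IOPoly π).coeff i := by
  rw [IOPoly, finsetSum_coeff]
  refine Finset.sum_nonneg fun ζ _ => ?_
  rw [coeff_X_pow]
  split_ifs <;> simp

theorem exists_cycleCount_mul_eq {n : ℕ} [NeZero n] (π : Perm (Fin n)) :
    ∃ d, ∀ ζ, cycleCount ζ = 1 → cycleCount (π * ζ) = d + 2 * ((cycleCount (π * ζ) - 1) / 2) := by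
  have h (ζ : Perm (Fin n)) (hζ : cycleCount ζ = 1) :
      (-1 : ℤˣ) ^ cycleCount (π * ζ) = -Perm.sign π := by
    have h1 := neg_one_pow_cycleCount ζ
    rw [hζ, pow_one] at h1
    rw [neg_one_pow_cycleCount, Perm.sign_mul, mul_left_comm, ← h1, mul_neg_one]
  rcases Int.units_eq_one_or (Perm.sign π) with hπ | hπ
  · refine ⟨1, fun ζ hζ => ?_⟩
    have h1 := h ζ hζ
    rcases Nat.even_or_odd (cycleCount (π * ζ)) with he | ⟨k, hk⟩
    · rw [he.neg_one_pow, hπ] at h1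
      exact absurd h1 (by decide)
    · lia
  · refine ⟨2, fun ζ hζ => ?_⟩
    have h1 := h ζ hζ
    have h2 := cycleCount_pos (π * ζ)
    rcases Nat.even_or_odd (cycleCount (π * ζ)) with ⟨k, hk⟩ | ho
    · lia
    · rw [ho.neg_one_pow, hπ] at h1
      exact absurd h1 (by decide)

theorem exists_eval_longCycleGenFun_eq {n : ℕ} [NeZero n] (π : Perm (Fin n)) :
    ∃ d, ∀ z : ℂ, (longCycleGenFun π).eval z = z ^ d * aeval (z ^ 2) (IOPoly π) := by
  obtain ⟨d, hd⟩ := exists_cycleCount_mul_eq π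
  refine ⟨d, fun z => ?_⟩
  rw [longCycleGenFun, IOPoly, ← Finset.sum_filter, eval_finsetSum, map_sum, Finset.mul_sum]
  refine Finset.sum_congr rfl fun ζ hζ => ?_
  rw [eval_pow, eval_X, map_pow, aeval_X, ← pow_mul, ← pow_add,
    ← hd ζ (Finset.mem_filter.1 hζ).2]

theorem im_eq_zero_and_re_nonpos_of_aeval_IOPoly_eq_zero {n : ℕ} [NeZero n] (π : Perm (Fin n))
    {w : ℂ} (hw : aeval w (IOPoly π) = 0) : w.im = 0 ∧ w.re ≤ 0 := by
  obtain ⟨z, rfl⟩ := IsAlgClosed.exists_pow_nat_eq w two_pos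
  obtain ⟨d, hd⟩ := exists_eval_longCycleGenFun_eq π
  have hz : z.re = 0 := re_eq_zero_of_eval_longCycleGenFun_eq_zero (π := π) (by
    rw [hd, hw, mul_zero])
  rw [pow_two, Complex.mul_im, Complex.mul_re, hz]
  constructor
  · ring
  · nlinarith [sq_nonneg z.im]

end IOPolynomial

/-- The IO-polynomial of every involution (fixed points allowed) is log-concave. -/
theorem stmt_3 (n : ℕ) (hn : 2 ≤ n) (π : Equiv.Perm (Fin n)) (hπ : π * π = 1) :
    ∀ k : ℕ, 1 ≤ k →
      (IOPoly π).coeff (k - 1) * (IOPoly π).coeff (k + 1) ≤ ((IOPoly π).coeff k) ^ 2 := by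
  intro k hk
  have : NeZero n := ⟨by lia⟩
  have h := (coeff_mul_coeff_le_of_roots_nonpos (IOPoly π)
    (fun _ => im_eq_zero_and_re_nonpos_of_aeval_IOPoly_eq_zero π)
    (coeff_IOPoly_nonneg π _)).2 (k - 1) k (by lia)
  rwa [Nat.sub_add_cancel hk, ← pow_two] at h
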